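/- Fix reals P_T > 0, N > 0, J_Max > 0, an integer N_T ≥ 1, and an integer m with 0 ≤ m ≤ N_T − 1. Define α_m by α_m⁻¹ = Σ_{i=0}^{m} (R_i)⁻¹ and let x̂ be the transmitter mixed strategy with x̂_i = α_m/R_i for 0 ≤ i ≤ m and x̂_i = 0 for i > m. If y and y' are two mixed strategies of the jammer both supported on indices {0,1,…,m+1} (i.e. y_j = y'_j = 0 for all j > m+1) that have the same average jamming power, Σ_j J_j·y_j = Σ_j J_j·y'_j where J_j = (j/N_T)·J_Max, then they yield the same expected payoff against x̂: x̂ᵀ C y = x̂ᵀ C y'. -/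

import Mathlib

open BigOperators

/-- Rate `R_i = (1/2)·log(1 + P_T/(N + (i/N_T)·J_Max))`. -/
noncomputable def rate (P_T N J_Max : ℝ) (N_T i : ℕ) : ℝ :=
  (1 / 2) * Real.log (1 + P_T / (N + ((i : ℝ) / (N_T : ℝ)) * J_Max))

/-- Payoff matrix `C_{i,j} = R_i` if `j ≤ i`, else `0`. -/
noncomputable def payC (P_T N J_Max : ℝ) (N_T : ℕ) (i j : Fin (N_T + 1)) : ℝ :=
  if (j : ℕ) ≤ (i : ℕ) then rate P_T N J_Max N_T (i : ℕ) else 0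

/-- Jamming power level `J_j = (j/N_T)·J_Max`. -/
noncomputable def jamPow (J_Max : ℝ) (N_T j : ℕ) : ℝ := ((j : ℝ) / (N_T : ℝ)) * J_Max

/-- Mixed strategy: nonnegative entries summing to one. -/
def IsMixed {n : ℕ} (x : Fin n → ℝ) : Prop := (∀ i, 0 ≤ x i) ∧ ∑ i, x i = 1

/-- Expected payoff `xᵀ C y`. -/
noncomputable def payoff (P_T N J_Max : ℝ) (N_T : ℕ) (x y : Fin (N_T + 1) → ℝ) : ℝ :=
  ∑ i, ∑ j, x i * payC P_T N J_Max N_T i j * y j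

/-- `α_m = (Σ_{i=0}^{m} R_i⁻¹)⁻¹`. -/
noncomputable def alpha (P_T N J_Max : ℝ) (N_T m : ℕ) : ℝ :=
  (∑ i ∈ Finset.range (m + 1), (rate P_T N J_Max N_T i)⁻¹)⁻¹

/-- Transmitter strategy `x̂` with `x̂_i = α_m / R_i` for `i ≤ m` and `0` otherwise. -/
noncomputable def xhat (P_T N J_Max : ℝ) (N_T m : ℕ) (i : Fin (N_T + 1)) : ℝ :=
  if (i : ℕ) ≤ m then alpha P_T N J_Max N_T m / rate P_T N J_Max N_T (i : ℕ) else 0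

lemma rate_pos_aux (P_T N J_Max : ℝ) (hP : 0 < P_T) (hN : 0 < N) (hJ : 0 < J_Max)
    (N_T i : ℕ) : 0 < rate P_T N J_Max N_T i := by
  unfold rate
  have h : 0 < P_T / (N + ((i : ℝ) / (N_T : ℝ)) * J_Max) := by positivity
  have := Real.log_pos (by linarith : 1 < 1 + P_T / (N + ((i : ℝ) / (N_T : ℝ)) * J_Max))
  positivity

lemma col_aux (P_T N J_Max : ℝ) (hP : 0 < P_T) (hN : 0 < N) (hJ : 0 < J_Max)
    (N_T : ℕ) (m : ℕ) (hm : m ≤ N_T) (j : Fin (N_T + 1)) (hj : (j : ℕ) ≤ m + 1) :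
    ∑ i, xhat P_T N J_Max N_T m i * payC P_T N J_Max N_T i j
      = alpha P_T N J_Max N_T m * ((m : ℝ) + 1 - (j : ℕ)) := by
  have h1 : ∀ i : Fin (N_T + 1), xhat P_T N J_Max N_T m i * payC P_T N J_Max N_T i j
      = (fun k : ℕ => if (j : ℕ) ≤ k ∧ k < m + 1 then alpha P_T N J_Max N_T m else 0) i := by
    intro i
    have hr := (rate_pos_aux P_T N J_Max hP hN hJ N_T i).ne'
    simp only [xhat, payC, Nat.lt_succ_iff]
    by_cases a : (i : ℕ) ≤ m <;> by_cases b : (j : ℕ) ≤ i <;> simp [a, b, hr]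
  rw [Finset.sum_congr rfl (fun i _ => h1 i), Fin.sum_univ_eq_sum_range
    (fun k : ℕ => if (j : ℕ) ≤ k ∧ k < m + 1 then alpha P_T N J_Max N_T m else 0), ← Finset.sum_filter]
  have h2 : (Finset.range (N_T + 1)).filter (fun k => (j : ℕ) ≤ k ∧ k < m + 1)
      = Finset.Ico (j : ℕ) (m + 1) := by
    ext k
    simp only [Finset.mem_filter, Finset.mem_range, Finset.mem_Ico]
    omega
  rw [h2, Finset.sum_const, Nat.card_Ico, nsmul_eq_mul, Nat.cast_sub hj]
  push_cast
  ring

lemma payoff_aux (P_T N J_Max : ℝ) (hP : 0 < P_T) (hN : 0 < N) (hJ : 0 < J_Max)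
    (N_T : ℕ) (hNT : 1 ≤ N_T) (m : ℕ) (hm : m ≤ N_T) (y : Fin (N_T + 1) → ℝ) (hy : IsMixed y)
    (h0 : ∀ j : Fin (N_T + 1), m + 1 < (j : ℕ) → y j = 0) :
    payoff P_T N J_Max N_T (xhat P_T N J_Max N_T m) y
      = alpha P_T N J_Max N_T m * ((m : ℝ) + 1 -
        (N_T / J_Max) * ∑ j : Fin (N_T + 1), jamPow J_Max N_T (j : ℕ) * y j) := by
  have hn : (N_T : ℝ) ≠ 0 := by positivity
  have e : (m : ℝ) + 1 = ∑ j, ((m : ℝ) + 1) * y j := by rw [← Finset.mul_sum, hy.2, mul_one]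
  unfold payoff
  rw [Finset.sum_comm, e, Finset.mul_sum, ← Finset.sum_sub_distrib, Finset.mul_sum]
  refine Finset.sum_congr rfl fun j _ => ?_
  rw [← Finset.sum_mul]
  by_cases hj : (j : ℕ) ≤ m + 1
  · rw [col_aux P_T N J_Max hP hN hJ N_T m hm j hj]
    unfold jamPow
    field_simp
  · rw [h0 j (by omega)]
    simp

theorem same_avg_power_same_payoff_against_xhat
    (P_T N J_Max : ℝ) (hP : 0 < P_T) (hN : 0 < N) (hJ : 0 < J_Max)
    (N_T : ℕ) (hNT : 1 ≤ N_T) (m : ℕ) (hm : m ≤ N_T - 1) :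
    ∀ y y' : Fin (N_T + 1) → ℝ, IsMixed y → IsMixed y' →
      (∀ j : Fin (N_T + 1), m + 1 < (j : ℕ) → y j = 0) →
      (∀ j : Fin (N_T + 1), m + 1 < (j : ℕ) → y' j = 0) →
      (∑ j : Fin (N_T + 1), jamPow J_Max N_T (j : ℕ) * y j =
        ∑ j : Fin (N_T + 1), jamPow J_Max N_T (j : ℕ) * y' j) →
      payoff P_T N J_Max N_T (xhat P_T N J_Max N_T m) y =
        payoff P_T N J_Max N_T (xhat P_T N J_Max N_T m) y' := by
  intro y y' hy hy' h0 h0' h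
  rw [payoff_aux P_T N J_Max hP hN hJ N_T hNT m (by omega) y hy h0,
    payoff_aux P_T N J_Max hP hN hJ N_T hNT m (by omega) y' hy' h0', h]
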